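/- arXiv:2209.07767 — 2 statements merged into one kernel-verified Lean document; each statement's English description precedes it below -/
import Mathlib

section
/- Fix ν > -1/2, α > 0 and a real k > k_* = max{-1, -2ν-1}. For β with |β| < α, let m_k(β) = ∫_ℝ |x|^k p_β(x) dx denote the k-th absolute moment of the variance-gamma density p_β with parameters (ν, α, β, 0), and let C = (2^k / (√π α^k)) Γ(ν + (k+1)/2) Γ((k+1)/2) / Γ(ν + 1/2). Then, as β → 0, m_k(β) = C·[1 + (k(k+2ν+2)/2)(β/α)² + (k(k³ + 4k²(ν+2) + 4k(ν²+3ν+4) - 8ν² + 8ν + 12)/24)(β/α)⁴ + O((β/α)⁶)]. -/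
open MeasureTheory Real Filter

/-- The modified Bessel function of the second kind `K_ν(x)`. -/
noncomputable def besselK (ν x : ℝ) : ℝ :=
  ∫ t in Set.Ioi (0 : ℝ), Real.exp (-x * Real.cosh t) * Real.cosh (ν * t)

/-- The variance-gamma density with parameters `(ν, α, β, 0)`. -/
noncomputable def vgDensity (ν α β x : ℝ) : ℝ :=
  (α ^ 2 - β ^ 2) ^ (ν + 1/2) / (Real.sqrt π * (2 * α) ^ ν * Real.Gamma (ν + 1/2)) *
    (Real.exp (β * x) * |x| ^ ν * besselK ν (α * |x|))

/-- The ascending factorial `(u)_j = u (u+1) ⋯ (u+j-1)`. -/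
noncomputable def ascFactorial (u : ℝ) (j : ℕ) : ℝ := ∏ i ∈ Finset.range j, (u + i)

/-- The Gaussian hypergeometric function `₂F₁(a, b; c; x)`. -/
noncomputable def hyp2F1 (a b c x : ℝ) : ℝ :=
  ∑' j : ℕ, ascFactorial a j * ascFactorial b j / ascFactorial c j * x ^ j / (Nat.factorial j)


lemma beta_real_aux {p q : ℝ} (hp : 0 < p) (hq : 0 < q) :
    IntegrableOn (fun y : ℝ => y ^ (p - 1) * (1 - y) ^ (q - 1)) (Set.Ioo 0 1) ∧
    ∫ y in Set.Ioo (0:ℝ) 1, y ^ (p - 1) * (1 - y) ^ (q - 1)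
      = Real.Gamma p * Real.Gamma q / Real.Gamma (p + q) := by
  have hc := Complex.betaIntegral_convergent (u := p) (v := q) (by simpa) (by simpa)
  rw [intervalIntegrable_iff_integrableOn_Ioc_of_le (by simp)] at hc
  have key : Set.EqOn (fun x : ℝ => RCLike.re ((x:ℂ) ^ ((p:ℂ) - 1) * (1 - (x:ℂ)) ^ ((q:ℂ) - 1)))
      (fun y : ℝ => y ^ (p - 1) * (1 - y) ^ (q - 1)) (Set.Ioc 0 1) := by
    intro x ⟨hx1, hx2⟩
    simp only
    norm_cast
    rw [← Complex.ofReal_cpow, ← Complex.ofReal_cpow, RCLike.re_to_complex,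
        Complex.re_mul_ofReal, Complex.ofReal_re]
    all_goals linarith
  constructor
  · rw [← integrableOn_Ioc_iff_integrableOn_Ioo]
    exact IntegrableOn.congr_fun hc.re key measurableSet_Ioc
  · have := ProbabilityTheory.beta_eq_betaIntegralReal p q hp hq
    rw [ProbabilityTheory.beta] at this
    rw [this, Complex.betaIntegral, intervalIntegral.integral_of_le (by norm_num),
      ← integral_Ioc_eq_integral_Ioo, ← RCLike.re_to_complex, ← integral_re hc]
    exact (setIntegral_congr_fun measurableSet_Ioc key).symm

lemma sigmoid_two_mul (t : ℝ) : Real.sigmoid (2 * t) = Real.exp t / (2 * Real.cosh t) := by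
  rw [Real.sigmoid_def, Real.cosh_eq, show -(2*t) = -t + -t by ring, Real.exp_add, Real.exp_neg]
  have := Real.exp_pos t
  field_simp

lemma exp_cosh_aux {s ν : ℝ} (h1 : ν < s) (h2 : -ν < s) :
    Integrable (fun t : ℝ => Real.exp (ν * t) / Real.cosh t ^ s) ∧
    ∫ t : ℝ, Real.exp (ν * t) / Real.cosh t ^ s
      = 2 ^ (s - 1) * (Real.Gamma ((s + ν)/2) * Real.Gamma ((s - ν)/2) / Real.Gamma s) := by
  obtain ⟨hi, he⟩ := beta_real_aux (p := (s+ν)/2) (q := (s-ν)/2) (by linarith) (by linarith)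
  have himg : (fun t : ℝ => Real.sigmoid (2 * t)) '' Set.univ = Set.Ioo 0 1 := by
    rw [← Real.range_sigmoid, Set.image_univ]
    ext y
    constructor
    · rintro ⟨t, rfl⟩; exact ⟨2*t, rfl⟩
    · rintro ⟨t, rfl⟩; exact ⟨t/2, by simp only; congr 1; ring⟩
  have hd : ∀ t ∈ (Set.univ : Set ℝ), HasDerivWithinAt (fun t : ℝ => Real.sigmoid (2 * t))
      (Real.sigmoid (2*t) * (1 - Real.sigmoid (2*t)) * 2) Set.univ t := by
    intro t _
    apply HasDerivAt.hasDerivWithinAt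
    have := (hasDerivAt_id t).const_mul 2
    simp only [id, mul_one] at this
    exact (Real.hasDerivAt_sigmoid (2*t)).comp t this
  have hinj : Set.InjOn (fun t : ℝ => Real.sigmoid (2 * t)) Set.univ := by
    intro x _ y _ hxy
    have := Real.sigmoid_injective hxy
    linarith
  rw [← himg] at hi he
  rw [integrableOn_image_iff_integrableOn_abs_deriv_smul MeasurableSet.univ hd hinj] at hi
  rw [integral_image_eq_integral_abs_deriv_smul MeasurableSet.univ hd hinj] at he
  have hfun : (fun t : ℝ => |Real.sigmoid (2*t) * (1 - Real.sigmoid (2*t)) * 2| •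
      (Real.sigmoid (2*t) ^ ((s+ν)/2 - 1) * (1 - Real.sigmoid (2*t)) ^ ((s-ν)/2 - 1)))
      = fun t => 2 ^ (1 - s) * (Real.exp (ν * t) / Real.cosh t ^ s) := by
    funext t
    have hc := Real.cosh_pos t
    have hy := Real.sigmoid_pos (2*t)
    have hy' : 0 < 1 - Real.sigmoid (2*t) := by linarith [Real.sigmoid_lt_one (2*t)]
    rw [abs_of_pos (by positivity), smul_eq_mul, Real.rpow_sub_one hy.ne', Real.rpow_sub_one hy'.ne']
    have e2 : 1 - Real.sigmoid (2*t) = Real.exp (-t) / (2 * Real.cosh t) := by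
      rw [← Real.sigmoid_neg, show -(2*t) = 2 * (-t) by ring, sigmoid_two_mul, Real.cosh_neg]
    have : Real.sigmoid (2*t) ^ ((s+ν)/2) * (1 - Real.sigmoid (2*t)) ^ ((s-ν)/2)
        = 2 ^ (- s) * (Real.exp (ν * t) / Real.cosh t ^ s) := by
      rw [e2, sigmoid_two_mul, Real.div_rpow (by positivity) (by positivity),
        Real.div_rpow (by positivity) (by positivity), ← Real.exp_mul, ← Real.exp_mul,
        div_mul_div_comm, ← Real.exp_add, ← Real.rpow_add (by positivity),
        Real.mul_rpow (by norm_num) hc.le, Real.rpow_neg (by norm_num)]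
      rw [show t * ((s+ν)/2) + -t * ((s-ν)/2) = ν * t by ring,
        show (s+ν)/2 + (s-ν)/2 = s by ring]
      field_simp
    rw [show (1 - s) = 1 + -s by ring, Real.rpow_add (by norm_num), Real.rpow_one, mul_assoc 2,
      ← this]
    field_simp
  rw [hfun, integrableOn_univ] at hi
  simp only [hfun, Measure.restrict_univ] at he
  rw [integral_const_mul, show (s+ν)/2 + (s-ν)/2 = s by ring] at he
  have h2 : (2:ℝ) ^ (s-1) * 2 ^ (1-s) = 1 := by
    rw [← Real.rpow_add (by norm_num)]; simp
  constructor
  · have := hi.const_mul ((2:ℝ) ^ (s-1))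
    simpa only [← mul_assoc, h2, one_mul] using this
  · rw [← he, ← mul_assoc, h2, one_mul]

lemma cosh_cosh_aux {s ν : ℝ} (h1 : ν < s) (h2 : -ν < s) :
    IntegrableOn (fun t : ℝ => Real.cosh (ν * t) / Real.cosh t ^ s) (Set.Ioi 0) ∧
    ∫ t in Set.Ioi (0:ℝ), Real.cosh (ν * t) / Real.cosh t ^ s
      = 2 ^ (s - 2) * (Real.Gamma ((s + ν)/2) * Real.Gamma ((s - ν)/2) / Real.Gamma s) := by
  obtain ⟨i1, e1⟩ := exp_cosh_aux h1 h2
  obtain ⟨i2, e2⟩ := exp_cosh_aux (s := s) (ν := -ν) h2 (by linarith)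
  have hf : (fun t : ℝ => Real.cosh (ν * t) / Real.cosh t ^ s) = fun t =>
      (1/2) * (Real.exp (ν * t) / Real.cosh t ^ s + Real.exp (-ν * t) / Real.cosh t ^ s) := by
    funext t
    rw [Real.cosh_eq (ν * t), neg_mul]; ring
  constructor
  · rw [hf]
    exact ((i1.add i2).const_mul _).integrableOn
  · have := integral_comp_abs (f := fun t : ℝ => Real.cosh (ν * t) / Real.cosh t ^ s)
    have h3 : ∀ t : ℝ, Real.cosh (ν * |t|) / Real.cosh |t| ^ s
        = Real.cosh (ν * t) / Real.cosh t ^ s := by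
      intro t
      rw [Real.cosh_abs]
      rcases abs_choice t with h | h <;> rw [h]
      rw [mul_neg, Real.cosh_neg]
    simp only [h3] at this
    have h4 : ∫ t : ℝ, Real.cosh (ν * t) / Real.cosh t ^ s = 2 ^ (s - 1) *
        (Real.Gamma ((s + ν)/2) * Real.Gamma ((s - ν)/2) / Real.Gamma s) := by
      rw [hf, integral_const_mul, integral_add i1 i2, e1, e2, sub_neg_eq_add, ← sub_eq_add_neg]
      ring
    rw [h4, show s - 1 = (s - 2) + 1 by ring, Real.rpow_add_one (by norm_num)] at this
    linarith

/-- joint integrand -/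
noncomputable def jointF (s ν c : ℝ) (x t : ℝ) : ℝ :=
  x ^ (s - 1) * (Real.exp (-(c * x) * Real.cosh t) * Real.cosh (ν * t))

lemma jointF_x {s ν c : ℝ} (hs : 0 < s) (hc : 0 < c) (t : ℝ) :
    IntegrableOn (fun x => jointF s ν c x t) (Set.Ioi 0) ∧
    ∫ x in Set.Ioi (0:ℝ), jointF s ν c x t
      = (1 / c) ^ s * Real.Gamma s * (Real.cosh (ν * t) / Real.cosh t ^ s) := by
  have hct := Real.cosh_pos t
  have hf : (fun x => jointF s ν c x t) = fun x =>
      (x ^ (s-1) * Real.exp (-((c * Real.cosh t) * x))) * Real.cosh (ν * t) := by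
    funext x
    unfold jointF
    rw [show -(c * x) * Real.cosh t = -((c * Real.cosh t) * x) by ring]; ring
  rw [hf]
  constructor
  · apply Integrable.mul_const
    have := integrableOn_rpow_mul_exp_neg_mul_rpow (p := 1) (s := s - 1) (b := c * Real.cosh t)
      (by linarith) (by norm_num) (by positivity)
    simp only [Real.rpow_one, neg_mul] at this
    exact this
  · rw [integral_mul_const, Real.integral_rpow_mul_exp_neg_mul_Ioi hs (by positivity),
      one_div, mul_inv, Real.mul_rpow (by positivity) (by positivity), Real.inv_rpow hct.le]
    simp only [one_div]; ring

lemma jointF_integrable {s ν c : ℝ} (hs : 0 < s) (h1 : ν < s) (h2 : -ν < s) (hc : 0 < c) :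
    Integrable (Function.uncurry (jointF s ν c))
      ((volume.restrict (Set.Ioi 0)).prod (volume.restrict (Set.Ioi 0))) := by
  rw [integrable_prod_iff']
  · refine ⟨Eventually.of_forall fun t => (jointF_x hs hc t).1, ?_⟩
    have : ∀ t, ∫ x in Set.Ioi (0:ℝ), ‖Function.uncurry (jointF s ν c) (x, t)‖
        = (1 / c) ^ s * Real.Gamma s * (Real.cosh (ν * t) / Real.cosh t ^ s) := by
      intro t
      rw [← (jointF_x hs hc t).2]
      refine setIntegral_congr_fun measurableSet_Ioi fun x hx => ?_
      simp only [Function.uncurry]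
      rw [Real.norm_of_nonneg]
      unfold jointF
      have : 0 < x := hx
      have := Real.cosh_pos (ν * t)
      positivity
    simp only [this]
    exact (cosh_cosh_aux h1 h2).1.const_mul _
  · apply Measurable.aestronglyMeasurable
    unfold jointF Function.uncurry
    fun_prop

lemma besselK_mellin {s ν c : ℝ} (hs : 0 < s) (h1 : ν < s) (h2 : -ν < s) (hc : 0 < c) :
    IntegrableOn (fun x => x ^ (s - 1) * besselK ν (c * x)) (Set.Ioi 0) ∧
    ∫ x in Set.Ioi (0:ℝ), x ^ (s - 1) * besselK ν (c * x)
      = (1 / c) ^ s * 2 ^ (s - 2) * (Real.Gamma ((s + ν)/2) * Real.Gamma ((s - ν)/2)) := by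
  have hj := jointF_integrable hs h1 h2 hc
  have hf : ∀ x, ∫ t in Set.Ioi (0:ℝ), jointF s ν c x t = x ^ (s - 1) * besselK ν (c * x) := by
    intro x
    unfold jointF besselK
    rw [integral_const_mul]
  constructor
  · have := hj.integral_prod_left
    simp only [Function.uncurry, hf] at this
    exact this
  · have := integral_integral_swap hj
    simp only [hf] at this
    rw [this]
    simp only [(jointF_x hs hc _).2]
    rw [integral_const_mul, (cosh_cosh_aux h1 h2).2]
    have := Real.Gamma_pos_of_pos hs
    field_simp

lemma besselK_nonneg (ν x : ℝ) : 0 ≤ besselK ν x := by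
  unfold besselK
  apply integral_nonneg
  intro t
  have := Real.cosh_pos (ν * t)
  simp only [Pi.zero_apply]
  positivity

lemma besselK_half {ν c : ℝ} (hc : 0 < c) :
    ∀ᵐ x ∂(volume.restrict (Set.Ioi (0:ℝ))),
      Real.exp (c * x) * besselK ν (2 * c * x) ≤ besselK ν (c * x) := by
  have hj := jointF_integrable (s := |ν| + 1) (ν := ν) (c := c) (by positivity)
    (by linarith [le_abs_self ν]) (by linarith [neg_le_abs ν]) hc
  filter_upwards [hj.prod_right_ae, ae_restrict_mem measurableSet_Ioi] with x hx hx0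
  have hx0 : 0 < x := hx0
  have hi : IntegrableOn (fun t => Real.exp (-(c * x) * Real.cosh t) * Real.cosh (ν * t))
      (Set.Ioi 0) := by
    have := hx.const_mul (x ^ (|ν| + 1 - 1))⁻¹
    refine this.congr (Eventually.of_forall fun t => ?_)
    simp only [Function.uncurry, jointF]
    rw [← mul_assoc, inv_mul_cancel₀ (by positivity), one_mul]
  unfold besselK
  rw [← integral_const_mul]
  refine integral_mono_of_nonneg (Eventually.of_forall fun t => ?_) hi
    (Eventually.of_forall fun t => ?_)
  · have := Real.cosh_pos (ν * t)
    simp only [Pi.zero_apply]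
    positivity
  · have := Real.cosh_pos (ν * t)
    simp only
    rw [← mul_assoc, ← Real.exp_add]
    gcongr
    have := Real.one_le_cosh t
    have := mul_nonneg (mul_pos hc hx0).le (sub_nonneg.2 this)
    nlinarith

lemma cosh_taylor (y : ℝ) :
    0 ≤ Real.cosh y - (1 + y^2/2 + y^4/24) ∧
    Real.cosh y - (1 + y^2/2 + y^4/24) ≤ y ^ 6 * Real.cosh y := by
  have h := Real.hasSum_cosh y
  have h3 := (hasSum_nat_add_iff' 3).2 h
  have hs : ∑ i ∈ Finset.range 3, y ^ (2 * i) / ((2*i).factorial : ℝ) = 1 + y^2/2 + y^4/24 := by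
    simp [Finset.sum_range_succ, Nat.factorial]
  rw [hs] at h3
  have h6 := h.mul_left (y^6)
  have hp : ∀ n : ℕ, 0 ≤ y ^ (2 * n) := fun n => by rw [pow_mul]; positivity
  constructor
  · exact h3.nonneg fun n => div_nonneg (hp _) (by positivity)
  · refine hasSum_le (fun n => ?_) h3 h6
    rw [show 2 * (n+3) = 6 + 2 * n by ring, pow_add, mul_div_assoc]
    have : 0 ≤ y^6 := by positivity
    gcongr
    · exact hp n
    · omega

lemma rpow_taylor (r : ℝ) :
    (fun u : ℝ => (1 - u) ^ r - (1 - r * u + r * (r - 1) / 2 * u^2)) =O[nhds 0]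
      fun u => u ^ 3 := by
  have h := (Real.one_add_rpow_hasFPowerSeriesAt_zero (a := r)).isBigO_sub_partialSum_pow 3
  have ht : Tendsto (fun u : ℝ => -u) (nhds 0) (nhds 0) := by
    simpa using (continuous_neg (G := ℝ)).tendsto 0
  have h2 := h.comp_tendsto ht
  have hsum : ∀ y : ℝ, (binomialSeries ℝ r).partialSum 3 y = 1 + r * y + r * (r-1)/2 * y^2 := by
    intro y
    have h2 : Ring.choose r 2 = r * (r - 1) / 2 := by
      have := Ring.descPochhammer_eq_factorial_smul_choose r 2
      simp [descPochhammer_succ_right, Polynomial.smeval_mul, Polynomial.smeval_sub] at this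
      linarith
    simp [FormalMultilinearSeries.partialSum, Finset.sum_range_succ, binomialSeries, h2]
    ring
  simp only [hsum] at h2
  refine (h2.congr_left fun u => ?_).trans (Asymptotics.IsBigO.of_bound 1 ?_)
  · simp only [Function.comp]
    rw [zero_add, ← sub_eq_add_neg]; ring
  · refine Eventually.of_forall fun u => ?_
    simp

lemma integrable_abs_of_Ioi {f : ℝ → ℝ} (hf : IntegrableOn f (Set.Ioi 0)) :
    Integrable (fun x => f |x|) := by
  have hf' : IntegrableOn (fun x => f |x|) (Set.Ioi 0) := by
    refine hf.congr_fun (fun x hx => ?_) measurableSet_Ioi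
    rw [abs_of_pos hx]
  have int_Iic : IntegrableOn (fun x ↦ f |x|) (Set.Iic 0) := by
    rw [← Measure.map_neg_eq_self (volume : Measure ℝ)]
    let m : MeasurableEmbedding fun x : ℝ => -x := (Homeomorph.neg ℝ).measurableEmbedding
    rw [m.integrableOn_map_iff]
    simp_rw [Function.comp_def, abs_neg, Set.neg_preimage, Set.neg_Iic, neg_zero]
    exact Iff.mpr integrableOn_Ici_iff_integrableOn_Ioi hf'
  rw [← integrableOn_univ, ← Set.Iic_union_Ioi (a := (0:ℝ))]
  exact int_Iic.union hf'

lemma moment_Ioi {ν k c : ℝ} (h1 : 0 < k + 1) (h2 : 0 < k + 2 * ν + 1) (hc : 0 < c) (n : ℕ) :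
    IntegrableOn (fun x => x ^ (2 * n) * (x ^ (k + ν) * besselK ν (c * x))) (Set.Ioi 0) ∧
    ∫ x in Set.Ioi (0:ℝ), x ^ (2 * n) * (x ^ (k + ν) * besselK ν (c * x))
      = (1 / c) ^ (k + ν + 1) * 2 ^ (k + ν - 1) * (4 / c ^ 2) ^ n *
        (Real.Gamma (ν + (k + 1)/2 + n) * Real.Gamma ((k + 1)/2 + n)) := by
  have hn : (0:ℝ) ≤ n := Nat.cast_nonneg n
  obtain ⟨hi, he⟩ := besselK_mellin (s := k + ν + 1 + 2 * n) (ν := ν) (c := c)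
    (by linarith) (by linarith) (by linarith) hc
  have hf : Set.EqOn (fun x => x ^ (k + ν + 1 + 2 * n - 1) * besselK ν (c * x))
      (fun x => x ^ (2 * n) * (x ^ (k + ν) * besselK ν (c * x))) (Set.Ioi 0) := by
    intro x hx
    simp only
    rw [← mul_assoc, ← Real.rpow_natCast, ← Real.rpow_add hx]
    congr 2
    push_cast; ring
  refine ⟨hi.congr_fun hf measurableSet_Ioi, ?_⟩
  rw [← setIntegral_congr_fun measurableSet_Ioi hf, he]
  rw [show (k + ν + 1 + 2 * n + ν) / 2 = ν + (k + 1)/2 + n by ring,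
    show (k + ν + 1 + 2 * n - ν) / 2 = (k + 1)/2 + n by ring]
  congr 1
  have e1 : (1 / c) ^ (k + ν + 1 + 2 * (n:ℝ)) = (1 / c) ^ (k + ν + 1) * (1 / c^2) ^ n := by
    rw [Real.rpow_add (by positivity), show 2 * (n:ℝ) = ((2 * n : ℕ) : ℝ) by push_cast; ring,
      Real.rpow_natCast, pow_mul]
    congr 2
    rw [div_pow, one_pow]
  have e2 : (2:ℝ) ^ (k + ν + 1 + 2 * (n:ℝ) - 2) = 2 ^ (k + ν - 1) * 4 ^ n := by
    rw [show k + ν + 1 + 2 * (n:ℝ) - 2 = (k + ν - 1) + ((2 * n : ℕ) : ℝ) by push_cast; ring,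
      Real.rpow_add (by positivity), Real.rpow_natCast, pow_mul]
    norm_num
  rw [e1, e2, show 4 / c^2 = (1 / c^2) * 4 by ring, mul_pow]
  ring

/-- The half-line weight. -/
noncomputable def vgW (ν k α x : ℝ) : ℝ := x ^ (k + ν) * besselK ν (α * x)

lemma vgW_exp {ν k α : ℝ} (hα : 0 < α) (h1 : 0 < k + 1) (h2 : 0 < k + 2 * ν + 1) (n : ℕ) :
    IntegrableOn (fun x => Real.exp (α / 2 * x) * (x ^ (2 * n) * vgW ν k α x)) (Set.Ioi 0) := by
  have hi := (moment_Ioi h1 h2 (half_pos hα) n).1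
  have hm := (moment_Ioi h1 h2 hα n).1.aestronglyMeasurable
  refine Integrable.mono' hi ?_ ?_
  · exact (Measurable.aestronglyMeasurable (by fun_prop)).mul hm
  · filter_upwards [besselK_half (ν := ν) (half_pos hα), ae_restrict_mem measurableSet_Ioi]
      with x hx hx0
    have hx0 : 0 < x := hx0
    have hk := besselK_nonneg ν (α * x)
    unfold vgW
    rw [Real.norm_of_nonneg (by positivity)]
    rw [show 2 * (α / 2) * x = α * x by ring] at hx
    calc _ = x ^ (2 * n) * (x ^ (k + ν) * (Real.exp (α / 2 * x) * besselK ν (α * x))) := by ring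
      _ ≤ _ := by gcongr

lemma full_integral {ν k α β : ℝ} (hα : 0 < α) (h1 : 0 < k + 1) (h2 : 0 < k + 2 * ν + 1)
    (hβ : |β| ≤ α / 2) :
    IntegrableOn (fun x => Real.cosh (β * x) * vgW ν k α x) (Set.Ioi 0) ∧
    ∫ x, Real.exp (β * x) * vgW ν k α |x|
      = 2 * ∫ x in Set.Ioi (0:ℝ), Real.cosh (β * x) * vgW ν k α x := by
  have hE := integrable_abs_of_Ioi (vgW_exp hα h1 h2 0)
  simp only [mul_zero, pow_zero, one_mul] at hE
  have hW := integrable_abs_of_Ioi (moment_Ioi h1 h2 hα 0).1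
  simp only [mul_zero, pow_zero, one_mul] at hW
  change Integrable (fun x => vgW ν k α |x|) at hW
  have hexp : ∀ b : ℝ, |b| ≤ α / 2 → Integrable (fun x => Real.exp (b * x) * vgW ν k α |x|) := by
    intro b hb
    refine Integrable.mono' hE ?_ ?_
    · exact (Measurable.aestronglyMeasurable (by fun_prop)).mul hW.aestronglyMeasurable
    · refine Eventually.of_forall fun x => ?_
      have hw : 0 ≤ vgW ν k α |x| := by
        unfold vgW
        have := besselK_nonneg ν (α * |x|)
        positivity
      rw [Real.norm_of_nonneg (by positivity)]
      refine mul_le_mul_of_nonneg_right (Real.exp_le_exp.2 ?_) hw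
      calc b * x ≤ |b * x| := le_abs_self _
        _ = |b| * |x| := abs_mul _ _
        _ ≤ _ := by gcongr
  have i1 := hexp β hβ
  have i2 := hexp (-β) (by rwa [abs_neg])
  have hcosh : ∀ x, Real.cosh (β * |x|) * vgW ν k α |x| = (1/2) *
      (Real.exp (β * x) * vgW ν k α |x| + Real.exp (-β * x) * vgW ν k α |x|) := by
    intro x
    have : Real.cosh (β * |x|) = Real.cosh (β * x) := by
      rcases abs_choice x with h | h <;> rw [h]
      rw [mul_neg, Real.cosh_neg]
    rw [this, Real.cosh_eq, neg_mul]; ring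
  constructor
  · have : Integrable (fun x => Real.cosh (β * |x|) * vgW ν k α |x|) := by
      simp only [hcosh]
      exact (i1.add i2).const_mul _
    refine this.integrableOn.congr_fun (fun x hx => ?_) measurableSet_Ioi
    simp only
    rw [abs_of_pos hx]
  · have h := integral_comp_abs (f := fun x => Real.cosh (β * x) * vgW ν k α x)
    simp only [hcosh] at h
    rw [integral_const_mul, integral_add i1 i2] at h
    have hs : ∫ x, Real.exp (-β * x) * vgW ν k α |x| = ∫ x, Real.exp (β * x) * vgW ν k α |x| := by
      rw [← integral_neg_eq_self]
      simp
    rw [hs] at h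
    linarith

lemma full_expansion {ν k α : ℝ} (hα : 0 < α) (h1 : 0 < k + 1) (h2 : 0 < k + 2 * ν + 1) :
    ∃ D : ℝ, ∀ β : ℝ, |β| ≤ α / 2 →
    |(∫ x, Real.exp (β * x) * vgW ν k α |x|) -
      (1 / α) ^ (k + ν + 1) * 2 ^ (k + ν) *
        (Real.Gamma (ν + (k + 1)/2) * Real.Gamma ((k + 1)/2)) *
      (1 + 2 * (ν + (k+1)/2) * ((k+1)/2) * (β/α)^2
        + 2/3 * (ν + (k+1)/2) * (ν + (k+1)/2 + 1) * ((k+1)/2) * ((k+1)/2 + 1) * (β/α)^4)|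
      ≤ D * |β/α| ^ 6 := by
  have hb : 0 < ν + (k+1)/2 := by linarith
  have ha : 0 < (k+1)/2 := by linarith
  obtain ⟨j0, e0⟩ := moment_Ioi h1 h2 hα 0
  obtain ⟨j1, e1⟩ := moment_Ioi h1 h2 hα 1
  obtain ⟨j2, e2⟩ := moment_Ioi h1 h2 hα 2
  have j3 := vgW_exp hα h1 h2 3
  have g1 : ∀ z : ℝ, 0 < z → Real.Gamma (z + 1) = z * Real.Gamma z :=
    fun z hz => Real.Gamma_add_one hz.ne'
  have g2 : ∀ z : ℝ, 0 < z → Real.Gamma (z + 2) = (z + 1) * (z * Real.Gamma z) := by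
    intro z hz
    rw [show z + 2 = (z + 1) + 1 by ring, g1 _ (by linarith), g1 z hz]
  simp only [Nat.cast_zero, Nat.cast_one, Nat.cast_ofNat, add_zero] at e0 e1 e2
  rw [g1 _ hb, g1 _ ha] at e1
  rw [g2 _ hb, g2 _ ha] at e2
  set G := Real.Gamma (ν + (k + 1)/2) * Real.Gamma ((k + 1)/2) with hG
  refine ⟨2 * α ^ 6 * ∫ x in Set.Ioi (0:ℝ), Real.exp (α / 2 * x) * (x ^ (2 * 3) * vgW ν k α x),
    fun β hβ => ?_⟩
  obtain ⟨jc, ec⟩ := full_integral hα h1 h2 hβ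
  rw [ec]
  have hp : (2:ℝ) ^ (k + ν) = 2 * 2 ^ (k + ν - 1) := by
    rw [show k + ν = (k + ν - 1) + 1 by ring, Real.rpow_add_one (by norm_num)]; ring_nf
  have hmain : (∫ x in Set.Ioi (0:ℝ), (vgW ν k α x + (β^2/2) * (x^(2*1) * vgW ν k α x)
      + (β^4/24) * (x^(2*2) * vgW ν k α x))) * 2 = (1 / α) ^ (k + ν + 1) * 2 ^ (k + ν) * G *
      (1 + 2 * (ν + (k+1)/2) * ((k+1)/2) * (β/α)^2
        + 2/3 * (ν + (k+1)/2) * (ν + (k+1)/2 + 1) * ((k+1)/2) * ((k+1)/2 + 1) * (β/α)^4) := by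
    simp only [mul_zero, pow_zero, one_mul] at j0 e0
    have j0' : IntegrableOn (fun x => vgW ν k α x) (Set.Ioi 0) := j0
    have j1' : IntegrableOn (fun x => (β^2/2) * (x^(2*1) * vgW ν k α x)) (Set.Ioi 0) :=
      Integrable.const_mul j1 _
    have j2' : IntegrableOn (fun x => (β^4/24) * (x^(2*2) * vgW ν k α x)) (Set.Ioi 0) :=
      Integrable.const_mul j2 _
    have j01 : IntegrableOn (fun x => vgW ν k α x + (β^2/2) * (x^(2*1) * vgW ν k α x))
      (Set.Ioi 0) := Integrable.add j0' j1'
    rw [integral_add j01 j2', integral_add j0' j1', integral_const_mul,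
      integral_const_mul]
    unfold vgW
    rw [e0, e1, e2, hp, hG]
    field_simp
    ring
  rw [← hmain, mul_comm _ (2:ℝ), ← mul_sub, ← integral_sub jc]
  swap
  · simp only [mul_zero, pow_zero, one_mul] at j0
    have j0' : IntegrableOn (fun x => vgW ν k α x) (Set.Ioi 0) := j0
    have j1' : IntegrableOn (fun x => (β^2/2) * (x^(2*1) * vgW ν k α x)) (Set.Ioi 0) :=
      Integrable.const_mul j1 _
    have j2' : IntegrableOn (fun x => (β^4/24) * (x^(2*2) * vgW ν k α x)) (Set.Ioi 0) :=
      Integrable.const_mul j2 _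
    exact (j0'.add j1').add j2'
  rw [abs_mul, abs_of_pos (by norm_num : (0:ℝ) < 2)]
  have hle : |∫ x in Set.Ioi (0:ℝ), (Real.cosh (β * x) * vgW ν k α x -
      (vgW ν k α x + (β^2/2) * (x^(2*1) * vgW ν k α x) + (β^4/24) * (x^(2*2) * vgW ν k α x)))|
      ≤ ∫ x in Set.Ioi (0:ℝ), β ^ 6 *
        (Real.exp (α / 2 * x) * (x ^ (2 * 3) * vgW ν k α x)) := by
    rw [← Real.norm_eq_abs]
    refine norm_integral_le_of_norm_le (Integrable.const_mul j3 _) ?_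
    filter_upwards [ae_restrict_mem measurableSet_Ioi] with x hx
    have hx : 0 < x := hx
    have hw : 0 ≤ vgW ν k α x := by
      unfold vgW
      have := besselK_nonneg ν (α * x)
      positivity
    obtain ⟨t1, t2⟩ := cosh_taylor (β * x)
    have hce : Real.cosh (β * x) ≤ Real.exp (α / 2 * x) := by
      rw [← Real.cosh_abs, abs_mul, abs_of_pos hx]
      have : Real.cosh (|β| * x) ≤ Real.exp (|β| * x) := by
        rw [Real.cosh_eq]
        have : Real.exp (-(|β| * x)) ≤ Real.exp (|β| * x) := by
          gcongr
          have : 0 ≤ |β| * x := by positivity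
          linarith
        linarith
      refine this.trans ?_
      gcongr
    have h6 : 0 ≤ (β * x)^6 := by positivity
    rw [show Real.cosh (β * x) * vgW ν k α x -
      (vgW ν k α x + (β^2/2) * (x^(2*1) * vgW ν k α x) + (β^4/24) * (x^(2*2) * vgW ν k α x))
      = (Real.cosh (β * x) - (1 + (β*x)^2/2 + (β*x)^4/24)) * vgW ν k α x by ring,
      Real.norm_of_nonneg (mul_nonneg t1 hw)]
    calc _ ≤ (β * x)^6 * Real.cosh (β * x) * vgW ν k α x := by gcongr
      _ ≤ (β * x)^6 * Real.exp (α / 2 * x) * vgW ν k α x := by gcongr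
      _ = _ := by ring
  rw [integral_const_mul] at hle
  have : |β/α|^6 = β^6/α^6 := by
    rw [← abs_pow, div_pow, abs_of_nonneg]
    positivity
  rw [this]
  calc _ ≤ 2 * _ := mul_le_mul_of_nonneg_left hle (by norm_num)
    _ = _ := by field_simp

lemma moment_eq {ν k α β : ℝ} (hα : 0 < α) :
    ∫ x : ℝ, |x| ^ k * vgDensity ν α β x =
      (α ^ 2 - β ^ 2) ^ (ν + 1/2) / (Real.sqrt π * (2 * α) ^ ν * Real.Gamma (ν + 1/2)) *
      ∫ x, Real.exp (β * x) * vgW ν k α |x| := by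
  rw [← integral_const_mul]
  refine integral_congr_ae ?_
  have : ∀ᵐ x : ℝ, x ≠ 0 := by
    simp [ae_iff, measure_singleton]
  filter_upwards [this] with x hx
  unfold vgDensity vgW
  rw [Real.rpow_add (abs_pos.2 hx)]
  ring

open Asymptotics in
theorem vg_abs_moment_expansion (ν α : ℝ) (hν : ν > -1/2) (hα : 0 < α)
    (k : ℝ) (hk : k > max (-1) (-2*ν - 1)) :
    (fun β : ℝ =>
        (∫ x : ℝ, |x| ^ k * vgDensity ν α β x) -
          (2 ^ k / (Real.sqrt π * α ^ k) *
              (Real.Gamma (ν + (k + 1)/2) * Real.Gamma ((k + 1)/2) / Real.Gamma (ν + 1/2))) *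
            (1 + k * (k + 2*ν + 2)/2 * (β/α) ^ 2 +
              k * (k ^ 3 + 4*k ^ 2*(ν + 2) + 4*k*(ν ^ 2 + 3*ν + 4) - 8*ν ^ 2 + 8*ν + 12)/24 *
                (β/α) ^ 4))
      =O[nhds (0 : ℝ)] fun β : ℝ => |β/α| ^ 6 := by
  obtain ⟨hk1, hk2⟩ := max_lt_iff.1 hk
  have h1 : 0 < k + 1 := by linarith
  have h2 : 0 < k + 2 * ν + 1 := by linarith
  have hr : 0 < ν + 1/2 := by linarith
  obtain ⟨D, hD⟩ := full_expansion hα h1 h2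
  simp only [moment_eq hα]
  set I : ℝ → ℝ := fun β => ∫ x, Real.exp (β * x) * vgW ν k α |x| with hI
  set A : ℝ := (1 / α) ^ (k + ν + 1) * 2 ^ (k + ν) *
        (Real.Gamma (ν + (k + 1)/2) * Real.Gamma ((k + 1)/2)) with hA
  set Q : ℝ → ℝ := fun β => 1 + 2 * (ν + (k+1)/2) * ((k+1)/2) * (β/α)^2
        + 2/3 * (ν + (k+1)/2) * (ν + (k+1)/2 + 1) * ((k+1)/2) * ((k+1)/2 + 1) * (β/α)^4 with hQ
  set r : ℝ := ν + 1/2 with hrdef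
  set P : ℝ → ℝ := fun β => 1 - r * (β/α)^2 + r * (r-1)/2 * ((β/α)^2)^2 with hP
  set N : ℝ := Real.sqrt π * (2 * α) ^ ν * Real.Gamma r with hN
  have hsmall : ∀ᶠ β : ℝ in nhds 0, |β| ≤ α / 2 := by
    have : Tendsto (fun β : ℝ => |β|) (nhds 0) (nhds 0) := by
      simpa using (continuous_abs (G := ℝ)).tendsto 0
    exact (this.eventually (gt_mem_nhds (half_pos hα))).mono fun _ h => h.le
  have hIbig : (fun β => I β - A * Q β) =O[nhds 0] fun β : ℝ => |β/α| ^ 6 := by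
    refine IsBigO.of_bound D ?_
    filter_upwards [hsmall] with β hβ
    rw [Real.norm_eq_abs, Real.norm_of_nonneg (by positivity)]
    exact hD β hβ
  have hbdd : ∀ f : ℝ → ℝ, Continuous f → f =O[nhds 0] fun _ : ℝ => (1:ℝ) := fun f hf =>
    (hf.tendsto 0).isBigO_one ℝ
  have h6 : (fun β : ℝ => |β/α| ^ 6) =O[nhds 0] fun _ : ℝ => (1:ℝ) := by
    apply hbdd
    fun_prop
  have hI1 : I =O[nhds 0] fun _ : ℝ => (1:ℝ) := by
    have := (hIbig.trans h6).add (hbdd (fun β => A * Q β) (by fun_prop))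
    simpa using this
  have hu : Tendsto (fun β : ℝ => (β/α)^2) (nhds 0) (nhds 0) := by
    have : Continuous fun β : ℝ => (β/α)^2 := by fun_prop
    simpa using this.tendsto 0
  have hPbig : (fun β : ℝ => (1 - (β/α)^2) ^ r - P β) =O[nhds 0] fun β : ℝ => |β/α| ^ 6 := by
    refine ((rpow_taylor r).comp_tendsto hu).congr_right fun β => ?_
    simp only [Function.comp]
    rw [← pow_mul, ← abs_pow, abs_of_nonneg (by positivity)]
  have t1 : (fun β => ((1 - (β/α)^2) ^ r - P β) * I β) =O[nhds 0] fun β : ℝ => |β/α| ^ 6 := by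
    simpa using hPbig.mul hI1
  have t2 : (fun β => P β * (I β - A * Q β)) =O[nhds 0] fun β : ℝ => |β/α| ^ 6 := by
    simpa using (hbdd P (by fun_prop)).mul hIbig
  set c1 : ℝ := 2 * (ν + (k+1)/2) * ((k+1)/2) with hc1
  set c2 : ℝ := 2/3 * (ν + (k+1)/2) * (ν + (k+1)/2 + 1) * ((k+1)/2) * ((k+1)/2 + 1) with hc2
  have t3 : (fun β => A * ((-r * c2 + r * (r-1)/2 * c1) + r*(r-1)/2 * c2 * (β/α)^2)
      * |β/α| ^ 6) =O[nhds 0] fun β : ℝ => |β/α| ^ 6 := by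
    simpa using (hbdd (fun β => A * ((-r * c2 + r * (r-1)/2 * c1) + r*(r-1)/2 * c2 * (β/α)^2))
      (by fun_prop)).mul (isBigO_refl (fun β : ℝ => |β/α| ^ 6) (nhds 0))
  have hsum := ((t1.add t2).add t3).const_mul_left (α ^ (2 * r) / N)
  refine hsum.congr' ?_ EventuallyEq.rfl
  filter_upwards [hsmall] with β hβ
  have hua : 0 ≤ 1 - (β/α)^2 := by
    have : |β/α| ≤ 1 := by
      rw [abs_div, abs_of_pos hα, div_le_one hα]; linarith
    have := (sq_le_one_iff_abs_le_one _).2 this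
    linarith
  have hpow : (α^2 - β^2) ^ r = α ^ (2 * r) * (1 - (β/α)^2) ^ r := by
    rw [Real.rpow_mul hα.le, ← Real.mul_rpow (by positivity) hua]
    congr 1
    rw [Real.rpow_two]
    field_simp
  have hC : 2 ^ k / (Real.sqrt π * α ^ k) *
      (Real.Gamma (ν + (k + 1)/2) * Real.Gamma ((k + 1)/2) / Real.Gamma r)
      = α ^ (2 * r) / N * A := by
    have hg := Real.Gamma_pos_of_pos hr
    have e1 : α ^ (2 * r) = α ^ (k + ν + 1) * α ^ ν / α ^ k := by
      rw [← Real.rpow_add hα, ← Real.rpow_sub hα, hrdef]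
      congr 1; ring
    rw [hN, hA, e1, Real.mul_rpow (by norm_num) hα.le, Real.div_rpow (by norm_num) hα.le,
      Real.one_rpow, Real.rpow_add (by norm_num : (0:ℝ) < 2)]
    have := Real.sqrt_pos.2 Real.pi_pos
    field_simp
  have habs : |β/α|^6 = (β/α)^6 := by
    rw [← abs_pow, abs_of_nonneg]
    positivity
  rw [hC, hpow, habs]
  simp only [hQ, hP, hc1, hc2, hrdef]
  ring
end

section
/- Fix ν > -1/2, α > 0 and a positive integer k, and set ℓ = ⌈k/2⌉ + 1/2 and m = k mod 2. For β with |β| < α, let μ_k(β) = ∫_ℝ x^k p_β(x) dx denote the k-th moment of the variance-gamma density p_β with parameters (ν, α, β, 0), and let C = ((2/α)^k (2β/α)^m / (√π Γ(ν+1/2))) Γ(ν + ℓ) Γ(ℓ). Then, as β → 0, μ_k(β) = C·[1 + (2ℓ(ℓ+ν)/(2m+1) - ν - 1/2)(β/α)² + (2ℓ(ℓ+1)(ℓ+ν)(ℓ+ν+1)/(4m²+8m+3) - ℓ(2ν+1)(ℓ+ν)/(2m+1) + (4ν²-1)/8)(β/α)⁴ + O((β/α)⁶)]. -/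
open MeasureTheory Real Filter

lemma beta_integrable (p q : ℝ) (hp : 0 < p) (hq : 0 < q) :
    IntegrableOn (fun x : ℝ => x ^ (p - 1) * (1 - x) ^ (q - 1)) (Set.Ioo 0 1) ∧
    ∫ x in Set.Ioo (0:ℝ) 1, x ^ (p - 1) * (1 - x) ^ (q - 1) =
      Real.Gamma p * Real.Gamma q / Real.Gamma (p + q) := by
  have h1 := Complex.betaIntegral_convergent (u := (p:ℂ)) (v := (q:ℂ)) (by simpa) (by simpa)
  have hEq : Set.EqOn (fun x : ℝ => ((x:ℂ) ^ ((p:ℂ) - 1) * (1 - (x:ℂ)) ^ ((q:ℂ) - 1)))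
      (fun x : ℝ => ((x ^ (p - 1) * (1 - x) ^ (q - 1) : ℝ) : ℂ)) (Set.Ioo 0 1) := by
    intro x hx
    have h2 : (0:ℝ) ≤ 1 - x := by linarith [hx.2]
    simp only
    rw [Complex.ofReal_mul, Complex.ofReal_cpow hx.1.le, Complex.ofReal_cpow h2]
    push_cast
    rfl
  rw [intervalIntegrable_iff_integrableOn_Ioo_of_le zero_le_one] at h1
  have h3 := (integrableOn_congr_fun hEq measurableSet_Ioo).1 h1
  refine ⟨by simpa [IntegrableOn] using h3.re, ?_⟩
  have h4 := Complex.betaIntegral_eq_Gamma_mul_div (p:ℂ) (q:ℂ) (by simpa) (by simpa)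
  rw [Complex.betaIntegral, intervalIntegral.integral_of_le zero_le_one,
    integral_Ioc_eq_integral_Ioo, setIntegral_congr_fun measurableSet_Ioo hEq,
    integral_complex_ofReal, ← Complex.ofReal_add, Complex.Gamma_ofReal, Complex.Gamma_ofReal,
    Complex.Gamma_ofReal] at h4
  exact_mod_cast h4

lemma cosh_integral_aux (p q : ℝ) (hp : 0 < p) (hq : 0 < q) :
    Integrable (fun t : ℝ => Real.exp ((p - q) * t) * (2 * Real.cosh t) ^ (-(p + q))) ∧
    ∫ t : ℝ, Real.exp ((p - q) * t) * (2 * Real.cosh t) ^ (-(p + q)) =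
      Real.Gamma p * Real.Gamma q / Real.Gamma (p + q) / 2 := by
  obtain ⟨hi, hv⟩ := beta_integrable p q hp hq
  set f : ℝ → ℝ := fun t => Real.exp t / (2 * Real.cosh t) with hf
  have hc : ∀ t, 0 < Real.cosh t := Real.cosh_pos
  have h1f : ∀ t, 1 - f t = Real.exp (-t) / (2 * Real.cosh t) := by
    intro t
    have := (hc t).ne'
    simp only [hf]
    field_simp
    rw [Real.cosh_eq]; ring
  have hfd : ∀ t, HasDerivAt f (2 * (2 * Real.cosh t) ^ (-2:ℝ)) t := by
    intro t
    have h := (Real.hasDerivAt_exp t).div ((Real.hasDerivAt_cosh t).const_mul 2)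
      (by have := hc t; positivity)
    refine HasDerivAt.congr_deriv h ?_
    rw [Real.rpow_neg (by have := hc t; positivity), Real.rpow_two]
    have := (hc t).ne'
    field_simp
    have e := Real.exp_add t (-t)
    rw [add_neg_cancel, Real.exp_zero] at e
    rw [Real.cosh_eq, Real.sinh_eq]; linear_combination -e
  have hmono : StrictMono f := by
    apply strictMono_of_hasDerivAt_pos hfd
    intro t; have := hc t; positivity
  have himg : f '' Set.univ = Set.Ioo 0 1 := by
    ext y
    constructor
    · rintro ⟨t, -, rfl⟩
      have h1 : 0 < f t := by have := hc t; simp only [hf]; positivity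
      have h2 : 0 < 1 - f t := by rw [h1f]; have := hc t; positivity
      exact ⟨h1, by linarith⟩
    · rintro ⟨h0, h1⟩
      refine ⟨Real.log (y / (1 - y)) / 2, trivial, ?_⟩
      have h2 : 0 < 1 - y := by linarith
      set t := Real.log (y / (1 - y)) / 2
      have e : Real.exp t * Real.exp t = y / (1 - y) := by
        rw [← Real.exp_add, add_halves, Real.exp_log (by positivity)]
      simp only [hf]
      rw [Real.cosh_eq, Real.exp_neg]
      have := Real.exp_pos t
      field_simp
      rw [sq, e]; field_simp; ring
  have hg : ∀ t, |2 * (2 * Real.cosh t) ^ (-2:ℝ)| • (f t ^ (p - 1) * (1 - f t) ^ (q - 1)) =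
      2 * (Real.exp ((p - q) * t) * (2 * Real.cosh t) ^ (-(p + q))) := by
    intro t
    have hct : 0 < 2 * Real.cosh t := by have := hc t; positivity
    rw [abs_of_pos (by positivity), h1f, smul_eq_mul]
    simp only [hf]
    rw [Real.div_rpow (Real.exp_pos _).le hct.le, Real.div_rpow (Real.exp_pos _).le hct.le,
      ← Real.exp_mul, ← Real.exp_mul, div_eq_mul_inv, div_eq_mul_inv, ← Real.rpow_neg hct.le,
      ← Real.rpow_neg hct.le]
    have e1 : Real.exp ((p - q) * t) = Real.exp (t * (p-1)) * Real.exp (-t * (q-1)) := by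
      rw [← Real.exp_add]; congr 1; ring
    have e2 : (2 * Real.cosh t) ^ (-(p + q)) = (2 * Real.cosh t) ^ (-2:ℝ) *
        (2 * Real.cosh t) ^ (-(p-1)) * (2 * Real.cosh t) ^ (-(q-1)) := by
      rw [← Real.rpow_add hct, ← Real.rpow_add hct]; congr 1; ring
    rw [e1, e2]; ring
  have hfd' : ∀ t ∈ Set.univ, HasDerivWithinAt f (2 * (2 * Real.cosh t) ^ (-2:ℝ)) Set.univ t :=
    fun t _ => (hfd t).hasDerivWithinAt
  constructor
  · have := (integrableOn_image_iff_integrableOn_abs_deriv_smul MeasurableSet.univ hfd'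
      hmono.injective.injOn (fun x => x ^ (p - 1) * (1 - x) ^ (q - 1))).1 (by rw [himg]; exact hi)
    simp only [hg, integrableOn_univ] at this
    simpa using this.const_mul (1/2)
  · have := integral_image_eq_integral_abs_deriv_smul MeasurableSet.univ hfd'
      hmono.injective.injOn (fun x => x ^ (p - 1) * (1 - x) ^ (q - 1))
    simp only [hg, Measure.restrict_univ] at this
    rw [himg, hv, integral_const_mul] at this
    linarith

lemma cosh_integral (p q : ℝ) (hp : 0 < p) (hq : 0 < q) :
    IntegrableOn (fun t : ℝ => Real.cosh ((p - q) * t) * (2 * Real.cosh t) ^ (-(p + q)))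
      (Set.Ioi 0) ∧
    ∫ t in Set.Ioi (0:ℝ), Real.cosh ((p - q) * t) * (2 * Real.cosh t) ^ (-(p + q)) =
      Real.Gamma p * Real.Gamma q / Real.Gamma (p + q) / 4 := by
  obtain ⟨h1, v1⟩ := cosh_integral_aux p q hp hq
  obtain ⟨h2, v2⟩ := cosh_integral_aux q p hq hp
  have hEq : ∀ t, Real.cosh ((p - q) * t) * (2 * Real.cosh t) ^ (-(p + q)) =
      (Real.exp ((p - q) * t) * (2 * Real.cosh t) ^ (-(p + q)) +
        Real.exp ((q - p) * t) * (2 * Real.cosh t) ^ (-(q + p))) / 2 := by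
    intro t
    rw [Real.cosh_eq ((p-q)*t), add_comm q p, show -((p-q)*t) = (q-p)*t by ring]; ring
  have hI : Integrable (fun t : ℝ => Real.cosh ((p - q) * t) * (2 * Real.cosh t) ^ (-(p + q))) := by
    simp only [hEq]
    exact (h1.add h2).div_const 2
  refine ⟨hI.integrableOn, ?_⟩
  have h3 : ∫ t, Real.cosh ((p - q) * t) * (2 * Real.cosh t) ^ (-(p + q)) =
      Real.Gamma p * Real.Gamma q / Real.Gamma (p + q) / 2 := by
    simp only [hEq]
    rw [integral_div, integral_add h1 h2, v1, v2, add_comm q p]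
    ring
  have h4 := integral_comp_abs
    (f := fun t => Real.cosh ((p - q) * t) * (2 * Real.cosh t) ^ (-(p + q)))
  have h5 : ∀ t, Real.cosh ((p - q) * |t|) = Real.cosh ((p - q) * t) := by
    intro t
    rcases abs_choice t with h | h <;> rw [h]
    rw [mul_neg, Real.cosh_neg]
  simp only [h5, Real.cosh_abs] at h4
  linarith

lemma bessel_kernel_measurable (ν a s b : ℝ) :
    Measurable (fun z : ℝ × ℝ => z.1 ^ (s - 1) * Real.exp (b * z.1) *
      (Real.exp (-(a * z.1) * Real.cosh z.2) * Real.cosh (ν * z.2))) := by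
  have h1 : Measurable (fun z : ℝ × ℝ => Real.cosh z.2) :=
    Real.measurable_cosh.comp measurable_snd
  have h2 : Measurable (fun z : ℝ × ℝ => Real.cosh (ν * z.2)) :=
    Real.measurable_cosh.comp (measurable_snd.const_mul ν)
  fun_prop

lemma bessel_kernel_slice (ν a s : ℝ) (ha : 0 < a) (hs : 0 < s) (t : ℝ) :
    IntegrableOn (fun x : ℝ => x ^ (s - 1) *
      (Real.exp (-(a * x) * Real.cosh t) * Real.cosh (ν * t))) (Set.Ioi 0) ∧
    ∫ x in Set.Ioi (0:ℝ), x ^ (s - 1) *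
      (Real.exp (-(a * x) * Real.cosh t) * Real.cosh (ν * t)) =
    (2 / a) ^ s * Real.Gamma s * (Real.cosh (ν * t) * (2 * Real.cosh t) ^ (-s)) := by
  have hc : 0 < Real.cosh t := Real.cosh_pos t
  have hac : 0 < a * Real.cosh t := by positivity
  have e : ∀ x : ℝ, x ^ (s - 1) * (Real.exp (-(a * x) * Real.cosh t) * Real.cosh (ν * t)) =
      x ^ (s - 1) * Real.exp (-(a * Real.cosh t * x)) * Real.cosh (ν * t) := by
    intro x
    rw [show -(a * x) * Real.cosh t = -(a * Real.cosh t * x) by ring]; ring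
  simp only [e]
  constructor
  · have h := integrableOn_rpow_mul_exp_neg_mul_rpow (p := 1) (s := s - 1) (b := a * Real.cosh t)
      (by linarith) one_pos hac
    simp only [Real.rpow_one, neg_mul] at h
    exact h.mul_const _
  · rw [integral_mul_const, Real.integral_rpow_mul_exp_neg_mul_Ioi hs hac, one_div,
      Real.inv_rpow hac.le, ← Real.rpow_neg hac.le,
      show (2 / a) = (a / 2)⁻¹ by rw [inv_div], Real.inv_rpow (by positivity),
      ← Real.rpow_neg (by positivity),
      show a * Real.cosh t = (a / 2) * (2 * Real.cosh t) by ring,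
      Real.mul_rpow (by positivity) (by positivity)]
    ring

lemma bessel_kernel_integrable (ν a s : ℝ) (ha : 0 < a) (h1 : 0 < s + ν) (h2 : 0 < s - ν) :
    Integrable (fun z : ℝ × ℝ => z.1 ^ (s - 1) *
      (Real.exp (-(a * z.1) * Real.cosh z.2) * Real.cosh (ν * z.2)))
      ((volume.restrict (Set.Ioi (0:ℝ))).prod (volume.restrict (Set.Ioi (0:ℝ)))) := by
  have hs : 0 < s := by linarith
  obtain ⟨hci, hcv⟩ := cosh_integral ((s + ν)/2) ((s - ν)/2) (by linarith) (by linarith)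
  rw [show (s + ν)/2 + (s - ν)/2 = s by ring, show (s + ν)/2 - (s - ν)/2 = ν by ring] at *
  have hm := bessel_kernel_measurable ν a s 0
  simp only [zero_mul, Real.exp_zero, mul_one] at hm
  rw [integrable_prod_iff' hm.aestronglyMeasurable]
  constructor
  · exact Filter.Eventually.of_forall fun t => (bessel_kernel_slice ν a s ha hs t).1
  · have : ∀ t : ℝ, ∫ x in Set.Ioi (0:ℝ), ‖x ^ (s - 1) *
      (Real.exp (-(a * x) * Real.cosh t) * Real.cosh (ν * t))‖ =
      (2 / a) ^ s * Real.Gamma s * (Real.cosh (ν * t) * (2 * Real.cosh t) ^ (-s)) := by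
      intro t
      rw [← (bessel_kernel_slice ν a s ha hs t).2]
      refine setIntegral_congr_fun measurableSet_Ioi fun x hx => ?_
      have hx' : (0:ℝ) < x := hx
      have := Real.cosh_pos (ν * t)
      exact Real.norm_of_nonneg (by positivity)
    simp only [this]
    exact hci.const_mul _

lemma bessel_mellin (ν a s : ℝ) (ha : 0 < a) (h1 : 0 < s + ν) (h2 : 0 < s - ν) :
    ∫ x in Set.Ioi (0:ℝ), x ^ (s - 1) * besselK ν (a * x) =
      (2 / a) ^ s * (Real.Gamma ((s + ν)/2) * Real.Gamma ((s - ν)/2)) / 4 := by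
  have hs : 0 < s := by linarith
  have hi := bessel_kernel_integrable ν a s ha h1 h2
  obtain ⟨hci, hcv⟩ := cosh_integral ((s + ν)/2) ((s - ν)/2) (by linarith) (by linarith)
  rw [show (s + ν)/2 + (s - ν)/2 = s by ring, show (s + ν)/2 - (s - ν)/2 = ν by ring] at *
  simp only [besselK, ← integral_const_mul]
  rw [integral_integral_swap hi]
  simp only [(bessel_kernel_slice ν a s ha hs _).2]
  rw [integral_const_mul, hcv]
  have := (Real.Gamma_pos_of_pos hs).ne'
  field_simp

lemma bessel_exp_integrable (ν a s b : ℝ) (ha : 0 < a) (hb : b ≤ a / 2)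
    (h1 : 0 < s + ν) (h2 : 0 < s - ν) :
    IntegrableOn (fun x => x ^ (s - 1) * Real.exp (b * x) * besselK ν (a * x)) (Set.Ioi 0) := by
  have hi := bessel_kernel_integrable ν (a / 2) s (by positivity) h1 h2
  have hm := bessel_kernel_measurable ν a s b
  have hi2 := hi.mono' hm.aestronglyMeasurable (by
    rw [Measure.prod_restrict]
    filter_upwards [ae_restrict_mem (measurableSet_Ioi.prod measurableSet_Ioi)] with z hz
    have hx : 0 < z.1 := hz.1
    have hc := Real.cosh_pos (ν * z.2)
    have hc1 := Real.one_le_cosh z.2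
    rw [Real.norm_of_nonneg (by positivity), mul_assoc, ← mul_assoc (Real.exp (b * z.1)),
      ← Real.exp_add]
    gcongr
    have : b * z.1 ≤ a / 2 * z.1 * Real.cosh z.2 := by
      calc b * z.1 ≤ a / 2 * z.1 := by gcongr
        _ ≤ _ := le_mul_of_one_le_right (by positivity) hc1
    linarith)
  have := hi2.integral_prod_left
  simp only [integral_const_mul] at this
  exact this

lemma integrable_comp_abs' {g : ℝ → ℝ} (hg : IntegrableOn g (Set.Ioi 0)) :
    Integrable (fun x => g |x|) := by
  have h1 : IntegrableOn (fun x => g |x|) (Set.Ioi 0) :=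
    (integrableOn_congr_fun (fun x hx => by
      have hx' : (0:ℝ) < x := hx
      simp [abs_of_pos hx']) measurableSet_Ioi).1 hg
  have h2 : IntegrableOn (fun x => g |x|) (Set.Iic 0) := by
    rw [← Measure.map_neg_eq_self (volume : Measure ℝ)]
    let m : MeasurableEmbedding fun x : ℝ => -x := (Homeomorph.neg ℝ).measurableEmbedding
    rw [m.integrableOn_map_iff]
    simp_rw [Function.comp_def, abs_neg, Set.neg_preimage, Set.neg_Iic, neg_zero]
    exact Iff.mpr integrableOn_Ici_iff_integrableOn_Ioi h1
  rw [← integrableOn_univ, ← Set.Iic_union_Ioi (a := (0:ℝ))]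
  exact h2.union h1

lemma besselK_measurable (ν : ℝ) : Measurable (besselK ν) := by
  have h : Measurable (fun z : ℝ × ℝ => Real.exp (-z.1 * Real.cosh z.2) * Real.cosh (ν * z.2)) := by
    have h1 : Measurable (fun z : ℝ × ℝ => Real.cosh z.2) :=
      Real.measurable_cosh.comp measurable_snd
    have h2 : Measurable (fun z : ℝ × ℝ => Real.cosh (ν * z.2)) :=
      Real.measurable_cosh.comp (measurable_snd.const_mul ν)
    fun_prop
  exact (h.stronglyMeasurable.integral_prod_right'
    (ν := volume.restrict (Set.Ioi (0:ℝ)))).measurable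

/-- The even kernel `|x|^ν K_ν(α|x|)`. -/
noncomputable def vgKer (ν α x : ℝ) : ℝ := |x| ^ ν * besselK ν (α * |x|)

lemma vgKer_nonneg (ν α x : ℝ) : 0 ≤ vgKer ν α x :=
  mul_nonneg (Real.rpow_nonneg (abs_nonneg _) _) (besselK_nonneg _ _)

lemma vgKer_neg (ν α x : ℝ) : vgKer ν α (-x) = vgKer ν α x := by simp [vgKer]

lemma vgKer_measurable (ν α : ℝ) : Measurable (vgKer ν α) := by
  have h1 : Measurable (fun x : ℝ => |x|) := continuous_abs.measurable
  exact (h1.pow_const ν).mul ((besselK_measurable ν).comp (h1.const_mul α))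

lemma vgKer_dom_integrable (ν α b : ℝ) (hν : ν > -1/2) (hα : 0 < α) (hb : b ≤ α / 2) (n : ℕ) :
    Integrable (fun x => |x| ^ n * Real.exp (b * |x|) * vgKer ν α x) := by
  have hn : (0:ℝ) ≤ n := Nat.cast_nonneg n
  have h := bessel_exp_integrable ν α (n + ν + 1) b hα hb (by linarith) (by linarith)
  have h2 : IntegrableOn (fun x : ℝ => x ^ n * Real.exp (b * x) * (x ^ ν * besselK ν (α * x)))
      (Set.Ioi 0) := by
    refine (integrableOn_congr_fun (fun x hx => ?_) measurableSet_Ioi).1 h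
    have hx' : (0:ℝ) < x := hx
    rw [show (n:ℝ) + ν + 1 - 1 = n + ν by ring, Real.rpow_add hx', Real.rpow_natCast]
    ring
  exact integrable_comp_abs' h2

lemma vgKer_moment_integrable (ν α : ℝ) (hν : ν > -1/2) (hα : 0 < α) (n : ℕ) :
    Integrable (fun x => x ^ n * vgKer ν α x) := by
  refine (vgKer_dom_integrable ν α 0 hν hα (by positivity) n).mono'
    (((measurable_id.pow_const n).mul (vgKer_measurable ν α)).aestronglyMeasurable) ?_
  refine Filter.Eventually.of_forall fun x => ?_
  simp [abs_of_nonneg (vgKer_nonneg ν α x)]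

lemma vgKer_moment_odd (ν α : ℝ) (n : ℕ) (hn : Odd n) : ∫ x, x ^ n * vgKer ν α x = 0 := by
  have h := integral_neg_eq_self (fun x => x ^ n * vgKer ν α x) volume
  simp only [vgKer_neg, hn.neg_pow, neg_mul, integral_neg] at h
  linarith

lemma vgKer_moment_even (ν α : ℝ) (hν : ν > -1/2) (hα : 0 < α) (n : ℕ) :
    ∫ x, x ^ (2 * n) * vgKer ν α x =
      (2 / α) ^ (2 * n) * (2 / α) ^ (ν + 1) *
        (Real.Gamma (ν + (n + 1/2)) * Real.Gamma ((n:ℝ) + 1/2)) / 2 := by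
  have hn : (0:ℝ) ≤ n := Nat.cast_nonneg n
  have h := integral_comp_abs (f := fun x => x ^ (2 * n) * (x ^ ν * besselK ν (α * x)))
  have e : ∀ x : ℝ, |x| ^ (2 * n) = x ^ (2 * n) := fun x => by rw [pow_mul, sq_abs, ← pow_mul]
  simp only [e] at h
  have h2 := bessel_mellin ν α (2 * n + ν + 1) hα (by linarith) (by linarith)
  have h3 : ∫ x in Set.Ioi (0:ℝ), x ^ (2 * n) * (x ^ ν * besselK ν (α * x)) =
      ∫ x in Set.Ioi (0:ℝ), x ^ (2 * (n:ℝ) + ν + 1 - 1) * besselK ν (α * x) := by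
    refine setIntegral_congr_fun measurableSet_Ioi fun x hx => ?_
    have hx' : (0:ℝ) < x := hx
    rw [show 2 * (n:ℝ) + ν + 1 - 1 = ((2 * n : ℕ) : ℝ) + ν by push_cast; ring,
      Real.rpow_add hx', Real.rpow_natCast]
    ring
  simp only [vgKer]
  rw [h, h3, h2, show 2 * (n:ℝ) + ν + 1 = ((2 * n : ℕ) : ℝ) + (ν + 1) by push_cast; ring,
      Real.rpow_add (by positivity), Real.rpow_natCast]
  rw [show (((2 * n : ℕ) : ℝ) + (ν + 1) + ν) / 2 = ν + (n + 1/2) by push_cast; ring,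
    show (((2 * n : ℕ) : ℝ) + (ν + 1) - ν) / 2 = n + 1/2 by push_cast; ring]
  ring

lemma exp_taylor_bound (y : ℝ) (n : ℕ) :
    |Real.exp y - ∑ j ∈ Finset.range n, y ^ j / (Nat.factorial j)| ≤ |y| ^ n * Real.exp |y| := by
  have h := Complex.norm_exp_sub_sum_le_norm_mul_exp (y:ℂ) n
  rw [Complex.norm_real] at h
  rw [← Real.norm_eq_abs, ← Complex.norm_real]
  push_cast
  exact h

lemma vgKer_expansion (ν α : ℝ) (hν : ν > -1/2) (hα : 0 < α) (k N : ℕ) :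
    ∃ B : ℝ, ∀ β : ℝ, |β| ≤ α / 2 →
      |(∫ x, x ^ k * (Real.exp (β * x) * vgKer ν α x)) -
        ∑ j ∈ Finset.range N, β ^ j / (Nat.factorial j) * ∫ x, x ^ (k + j) * vgKer ν α x| ≤
      B * |β| ^ N := by
  refine ⟨∫ x, |x| ^ (k + N) * Real.exp (α / 2 * |x|) * vgKer ν α x, fun β hβ => ?_⟩
  have hexp : ∀ x : ℝ, |β * x| ≤ α / 2 * |x| := fun x => by rw [abs_mul]; gcongr
  have hI : Integrable (fun x => x ^ k * (Real.exp (β * x) * vgKer ν α x)) := by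
    refine (vgKer_dom_integrable ν α (α/2) hν hα le_rfl k).mono' ?_ ?_
    · have := vgKer_measurable ν α
      exact Measurable.aestronglyMeasurable (by fun_prop)
    · refine Filter.Eventually.of_forall fun x => ?_
      have := vgKer_nonneg ν α x
      rw [norm_mul, norm_mul, norm_pow, Real.norm_eq_abs, Real.norm_of_nonneg (Real.exp_pos _).le,
        Real.norm_of_nonneg this, ← mul_assoc]
      have := (le_abs_self _).trans (hexp x)
      gcongr |x| ^ k * ?_ * _
      exact Real.exp_le_exp.2 this
  have hJ : ∀ j ∈ Finset.range N, Integrable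
      (fun x => β ^ j / (Nat.factorial j) * (x ^ (k + j) * vgKer ν α x)) :=
    fun j _ => (vgKer_moment_integrable ν α hν hα (k + j)).const_mul _
  simp only [← integral_const_mul]
  rw [← integral_finsetSum _ hJ, ← integral_sub hI (integrable_finsetSum _ hJ), mul_comm,
    ← integral_const_mul, ← Real.norm_eq_abs]
  refine norm_integral_le_of_norm_le
    ((vgKer_dom_integrable ν α (α/2) hν hα le_rfl (k + N)).const_mul _) ?_
  refine Filter.Eventually.of_forall fun x => ?_
  have hG := vgKer_nonneg ν α x
  have e : x ^ k * (Real.exp (β * x) * vgKer ν α x) -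
      ∑ j ∈ Finset.range N, β ^ j / (Nat.factorial j) * (x ^ (k + j) * vgKer ν α x) =
      x ^ k * (Real.exp (β * x) - ∑ j ∈ Finset.range N, (β * x) ^ j / (Nat.factorial j)) *
        vgKer ν α x := by
    rw [mul_sub, sub_mul, Finset.mul_sum, Finset.sum_mul]
    congr 1
    · ring
    · refine Finset.sum_congr rfl fun j _ => ?_
      rw [mul_pow, pow_add]; ring
  rw [e, norm_mul, norm_mul, norm_pow, Real.norm_eq_abs, Real.norm_eq_abs,
    Real.norm_of_nonneg hG]
  calc |x| ^ k * |Real.exp (β * x) - ∑ j ∈ Finset.range N, (β * x) ^ j / (Nat.factorial j)| *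
        vgKer ν α x ≤ |x| ^ k * (|β * x| ^ N * Real.exp |β * x|) * vgKer ν α x := by
        gcongr; exact exp_taylor_bound _ _
    _ ≤ |x| ^ k * (|β * x| ^ N * Real.exp (α / 2 * |x|)) * vgKer ν α x := by
        gcongr; exact hexp x
    _ = _ := by rw [abs_mul, mul_pow, pow_add]; ring

open Asymptotics in
lemma binom_expansion (a : ℝ) :
    (fun b : ℝ => (1 - b ^ 2) ^ a - (1 - a * b ^ 2 + a * (a - 1) / 2 * b ^ 4))
      =O[nhds 0] fun b : ℝ => b ^ 6 := by
  have h := (Real.one_add_rpow_hasFPowerSeriesAt_zero (a := a)).isBigO_sub_partialSum_pow 3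
  have ht : Filter.Tendsto (fun b : ℝ => -b ^ 2) (nhds 0) (nhds 0) := by
    have : Continuous (fun b : ℝ => -b ^ 2) := by fun_prop
    simpa using this.tendsto 0
  have h2 := h.comp_tendsto ht
  have c2 : Ring.choose a 2 = a * (a - 1) / 2 := by
    rw [Ring.choose_eq_smul]
    simp [descPochhammer_succ_right, Polynomial.smeval_mul]
    ring
  refine (h2.congr_left fun b => ?_).trans (IsBigO.of_bound 1 ?_)
  · simp [FormalMultilinearSeries.partialSum, Finset.sum_range_succ, binomialSeries_apply, c2,
      -FormalMultilinearSeries.apply_eq_prod_smul_coeff]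
    ring
  · refine Filter.Eventually.of_forall fun b => ?_
    simp only [Function.comp, norm_pow, norm_neg, norm_norm, one_mul]
    rw [← pow_mul]

lemma vg_sum (ν α : ℝ) (hν : ν > -1/2) (hα : 0 < α) (k L m : ℕ) (hm : m = 0 ∨ m = 1)
    (hkL : k + m = 2 * L) (β : ℝ) :
    ∑ j ∈ Finset.range (6 + m), β ^ j / (Nat.factorial j) * ∫ x, x ^ (k + j) * vgKer ν α x =
      β ^ m * ((2 / α) ^ (2 * L) * (2 / α) ^ (ν + 1) *
        (Real.Gamma (ν + (L + 1/2)) * Real.Gamma ((L:ℝ) + 1/2)) / 2) *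
      (1 + 2 * ((L:ℝ) + 1/2) * (((L:ℝ) + 1/2) + ν) / (2 * (m:ℝ) + 1) * (β/α) ^ 2 +
        2 * ((L:ℝ) + 1/2) * (((L:ℝ) + 1/2) + 1) * (((L:ℝ) + 1/2) + ν) * (((L:ℝ) + 1/2) + ν + 1) /
          (4 * (m:ℝ) ^ 2 + 8 * (m:ℝ) + 3) * (β/α) ^ 4) := by
  have hL : (0:ℝ) ≤ L := Nat.cast_nonneg L
  have M0 := vgKer_moment_even ν α hν hα L
  have M1 := vgKer_moment_even ν α hν hα (L + 1)
  have M2 := vgKer_moment_even ν α hν hα (L + 2)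
  by_cases h0 : ν + ((L:ℝ) + 1/2) = 0
  · linarith
  have g1 : Real.Gamma (((L + 1 : ℕ):ℝ) + 1/2) = ((L:ℝ) + 1/2) * Real.Gamma ((L:ℝ) + 1/2) := by
    rw [← Real.Gamma_add_one (by positivity)]; congr 1; push_cast; ring
  have g2 : Real.Gamma (((L + 2 : ℕ):ℝ) + 1/2) =
      ((L:ℝ) + 1/2 + 1) * (((L:ℝ) + 1/2) * Real.Gamma ((L:ℝ) + 1/2)) := by
    rw [← Real.Gamma_add_one (by positivity), ← Real.Gamma_add_one (by positivity)]
    congr 1; push_cast; ring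
  have g3 : Real.Gamma (ν + (((L + 1 : ℕ):ℝ) + 1/2)) =
      (ν + ((L:ℝ) + 1/2)) * Real.Gamma (ν + ((L:ℝ) + 1/2)) := by
    rw [← Real.Gamma_add_one h0]; congr 1; push_cast; ring
  have g4 : Real.Gamma (ν + (((L + 2 : ℕ):ℝ) + 1/2)) =
      (ν + ((L:ℝ) + 1/2) + 1) * ((ν + ((L:ℝ) + 1/2)) * Real.Gamma (ν + ((L:ℝ) + 1/2))) := by
    rw [← Real.Gamma_add_one h0, ← Real.Gamma_add_one (by linarith)]; congr 1; push_cast; ring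
  rw [g1, g3] at M1
  rw [g2, g4] at M2
  generalize Real.Gamma (ν + ((L:ℝ) + 1/2)) = G1 at *
  generalize Real.Gamma ((L:ℝ) + 1/2) = G2 at *
  generalize (2 / α) ^ (ν + 1) = G3 at *
  have e1 : (2 / α) ^ (2 * (L + 1)) = (2 / α) ^ (2 * L) * (2 / α) ^ 2 := by
    rw [← pow_add]; rfl
  have e2 : (2 / α) ^ (2 * (L + 2)) = (2 / α) ^ (2 * L) * (2 / α) ^ 4 := by
    rw [← pow_add]; rfl
  rw [e1] at M1
  rw [e2] at M2
  generalize (2 / α) ^ (2 * L) = G4 at *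
  have hodd : ∀ n, Odd n → ∫ x, x ^ n * vgKer ν α x = 0 := vgKer_moment_odd ν α
  generalize hI : (fun n : ℕ => ∫ x, x ^ n * vgKer ν α x) = I at *
  have hI' : ∀ n : ℕ, ∫ x, x ^ n * vgKer ν α x = I n := fun n => congrFun hI n
  simp only [hI'] at *
  have hα' := hα.ne'
  rcases hm with rfl | rfl
  · have hk : k = 2 * L := by omega
    subst hk
    have o1 := hodd (2 * L + 1) ⟨L, by ring⟩
    have o3 := hodd (2 * L + 3) ⟨L + 1, by ring⟩
    have o5 := hodd (2 * L + 5) ⟨L + 2, by ring⟩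
    have M1' : I (2 * L + 2) = _ := M1
    have M2' : I (2 * L + 4) = _ := M2
    simp only [Finset.sum_range_succ, Finset.sum_range_zero, add_zero, M0, M1', M2', o1, o3, o5,
      Nat.factorial]
    push_cast
    field_simp
    ring
  · have hk : k + 1 = 2 * L := hkL
    have o1 := hodd (k + 0) ⟨L - 1, by omega⟩
    have o3 := hodd (k + 2) ⟨L, by omega⟩
    have o5 := hodd (k + 4) ⟨L + 1, by omega⟩
    have o7 := hodd (k + 6) ⟨L + 2, by omega⟩
    have M0' := M0
    rw [← hk] at M0'
    have M1' := M1
    rw [show 2 * (L + 1) = k + 3 by omega] at M1'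
    have M2' := M2
    rw [show 2 * (L + 2) = k + 5 by omega] at M2'
    simp only [Finset.sum_range_succ, Finset.sum_range_zero, M0', M1', M2', o1, o3, o5, o7,
      Nat.factorial]
    push_cast
    field_simp
    ring

lemma vg_pref (ν α : ℝ) (hα : 0 < α) (k L m : ℕ)
    (hkL : k + m = 2 * L) (β G W : ℝ) (hβ : |β| ≤ α / 2) :
    (α ^ 2 - β ^ 2) ^ (ν + 1/2) / (Real.sqrt π * (2 * α) ^ ν * G) *
      (β ^ m * ((2 / α) ^ (2 * L) * (2 / α) ^ (ν + 1) * W / 2)) =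
    ((2/α) ^ k * (2*β/α) ^ m / (Real.sqrt π * G) * W) * (1 - (β/α) ^ 2) ^ (ν + 1/2) := by
  have h1 : 0 ≤ 1 - (β/α) ^ 2 := by
    have : |β / α| ≤ 1 := by rw [abs_div, abs_of_pos hα, div_le_one hα]; linarith
    have := (sq_le_one_iff_abs_le_one (β/α)).2 this
    linarith
  have e1 : α ^ 2 - β ^ 2 = α ^ 2 * (1 - (β/α) ^ 2) := by field_simp
  have e2 : (α ^ 2) ^ (ν + 1/2) = α ^ ν * α ^ ν * α := by
    rw [← Real.rpow_natCast, ← Real.rpow_mul hα.le, ← Real.rpow_add hα]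
    nth_rewrite 3 [← Real.rpow_one α]
    rw [← Real.rpow_add hα]
    congr 1; push_cast; ring
  have e3 : (2 / α) ^ (ν + 1) = 2 ^ ν / α ^ ν * (2 / α) := by
    rw [Real.rpow_add_one (by positivity), Real.div_rpow (by norm_num) hα.le]
  have e4 : (2 * α) ^ ν = 2 ^ ν * α ^ ν := Real.mul_rpow (by norm_num) hα.le
  rw [e1, Real.mul_rpow (by positivity) h1, e2, e3, e4, ← hkL, pow_add,
    show 2 * β / α = (2 / α) * β by ring, mul_pow (2 / α) β]
  have p1 : 0 < α ^ ν := Real.rpow_pos_of_pos hα _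
  have p2 : (0:ℝ) < 2 ^ ν := Real.rpow_pos_of_pos (by norm_num) _
  have p3 : 0 < Real.sqrt π := Real.sqrt_pos.2 Real.pi_pos
  generalize (1 - (β/α) ^ 2) ^ (ν + 1/2) = Z
  generalize (2 / α) ^ k = Z1
  generalize (2 / α) ^ m = Z2
  rcases eq_or_ne G 0 with rfl | hG
  · simp
  field_simp

open Asymptotics in
lemma vg_core (ν α : ℝ) (hν : ν > -1/2) (hα : 0 < α) (k L m : ℕ) (hm : m = 0 ∨ m = 1)
    (hkL : k + m = 2 * L) :
    (fun β : ℝ =>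
        (∫ x : ℝ, x ^ k * vgDensity ν α β x) -
          ((2/α) ^ k * (2*β/α) ^ m / (Real.sqrt π * Real.Gamma (ν + 1/2)) *
              (Real.Gamma (ν + ((L : ℝ) + 1/2)) * Real.Gamma ((L : ℝ) + 1/2))) *
            (1 +
              (2 * ((L : ℝ) + 1/2) * (((L : ℝ) + 1/2) + ν) /
                  (2 * ((m : ℕ) : ℝ) + 1) - ν - 1/2) * (β/α) ^ 2 +
              (2 * ((L : ℝ) + 1/2) * (((L : ℝ) + 1/2) + 1) *
                  (((L : ℝ) + 1/2) + ν) * (((L : ℝ) + 1/2) + ν + 1) /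
                  (4 * ((m : ℕ) : ℝ) ^ 2 + 8 * ((m : ℕ) : ℝ) + 3) -
                ((L : ℝ) + 1/2) * (2*ν + 1) * (((L : ℝ) + 1/2) + ν) /
                  (2 * ((m : ℕ) : ℝ) + 1) +
                (4*ν ^ 2 - 1)/8) * (β/α) ^ 4))
      =O[nhds (0 : ℝ)]
        fun β : ℝ => |β/α| ^ 6 *
          ((2/α) ^ k * (2*β/α) ^ m / (Real.sqrt π * Real.Gamma (ν + 1/2)) *
            (Real.Gamma (ν + ((L : ℝ) + 1/2)) * Real.Gamma ((L : ℝ) + 1/2))) := by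
  have hL : (0:ℝ) ≤ L := Nat.cast_nonneg L
  have hG0 : 0 < Real.Gamma (ν + 1/2) := Real.Gamma_pos_of_pos (by linarith)
  have hW : 0 < Real.Gamma (ν + ((L : ℝ) + 1/2)) * Real.Gamma ((L : ℝ) + 1/2) :=
    mul_pos (Real.Gamma_pos_of_pos (by linarith)) (Real.Gamma_pos_of_pos (by linarith))
  have hsum := vg_sum ν α hν hα k L m hm hkL
  obtain ⟨B, hB⟩ := vgKer_expansion ν α hν hα k (6 + m)
  have hpi : 0 < Real.sqrt π := Real.sqrt_pos.2 Real.pi_pos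
  simp only [hsum] at hB
  have hpref := fun β hβ => vg_pref ν α hα k L m hkL β (Real.Gamma (ν + 1/2))
    (Real.Gamma (ν + ((L : ℝ) + 1/2)) * Real.Gamma ((L : ℝ) + 1/2)) hβ
  generalize Real.Gamma (ν + ((L : ℝ) + 1/2)) * Real.Gamma ((L : ℝ) + 1/2) = W at *
  set q1 : ℝ := 2 * ((L : ℝ) + 1/2) * (((L : ℝ) + 1/2) + ν) / (2 * ((m : ℕ) : ℝ) + 1) with hq1
  set q2 : ℝ := 2 * ((L : ℝ) + 1/2) * (((L : ℝ) + 1/2) + 1) *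
                  (((L : ℝ) + 1/2) + ν) * (((L : ℝ) + 1/2) + ν + 1) /
                  (4 * ((m : ℕ) : ℝ) ^ 2 + 8 * ((m : ℕ) : ℝ) + 3) with hq2
  have hcross : ((L : ℝ) + 1/2) * (2*ν + 1) * (((L : ℝ) + 1/2) + ν) / (2 * ((m : ℕ) : ℝ) + 1) =
      (ν + 1/2) * q1 := by rw [hq1]; ring
  rw [hcross]
  set C : ℝ → ℝ := fun β => (2/α) ^ k * (2*β/α) ^ m / (Real.sqrt π * Real.Gamma (ν + 1/2)) * W
    with hC
  set pref : ℝ → ℝ := fun β => (α ^ 2 - β ^ 2) ^ (ν + 1/2) /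
    (Real.sqrt π * (2 * α) ^ ν * Real.Gamma (ν + 1/2)) with hpf
  set U : ℝ := (2 / α) ^ (2 * L) * (2 / α) ^ (ν + 1) * W / 2 with hU
  set E : ℝ → ℝ := fun β => ∫ x, x ^ k * (Real.exp (β * x) * vgKer ν α x) with hE
  set R : ℝ → ℝ := fun β => E β - β ^ m * U * (1 + q1 * (β/α) ^ 2 + q2 * (β/α) ^ 4) with hR
  have hμ : ∀ β, (∫ x : ℝ, x ^ k * vgDensity ν α β x) = pref β * E β := by
    intro β
    simp only [hE, hpf, ← integral_const_mul]
    refine integral_congr_ae (Filter.Eventually.of_forall fun x => ?_)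
    simp only [vgDensity, vgKer]
    ring
  have hev : ∀ᶠ β in nhds (0:ℝ), |β| ≤ α / 2 := by
    have := Metric.closedBall_mem_nhds (0:ℝ) (half_pos hα)
    filter_upwards [this] with β hβ
    simpa using hβ
  have hbin : (fun β : ℝ => (1 - (β/α) ^ 2) ^ (ν + 1/2) - (1 - (ν + 1/2) * (β/α) ^ 2 +
      (ν + 1/2) * ((ν + 1/2) - 1) / 2 * (β/α) ^ 4)) =O[nhds 0] fun β : ℝ => |β/α| ^ 6 := by
    have ht : Filter.Tendsto (fun β : ℝ => β / α) (nhds 0) (nhds 0) := by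
      have : Continuous (fun β : ℝ => β / α) := by fun_prop
      simpa using this.tendsto 0
    have := (binom_expansion (ν + 1/2)).comp_tendsto ht
    refine this.trans (IsBigO.of_bound 1 (Filter.Eventually.of_forall fun β => ?_))
    simp [abs_div]
  have hone : ∀ f : ℝ → ℝ, Continuous f → f =O[nhds (0:ℝ)] fun _ => (1:ℝ) := fun f hf =>
    (hf.tendsto 0).isBigO_one ℝ
  have hb6 : (fun β : ℝ => (β/α) ^ 6) =O[nhds (0:ℝ)] fun β : ℝ => |β/α| ^ 6 :=
    IsBigO.of_bound 1 (Filter.Eventually.of_forall fun β => by simp [abs_div])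
  -- first part
  have hA : (fun β : ℝ => (1 - (β/α) ^ 2) ^ (ν + 1/2) * (1 + q1 * (β/α) ^ 2 + q2 * (β/α) ^ 4) -
      (1 + (q1 - ν - 1/2) * (β/α) ^ 2 + (q2 - (ν + 1/2) * q1 + (4*ν ^ 2 - 1)/8) * (β/α) ^ 4))
      =O[nhds (0:ℝ)] fun β : ℝ => |β/α| ^ 6 := by
    have t1 := hbin.mul (hone (fun β : ℝ => 1 + q1 * (β/α) ^ 2 + q2 * (β/α) ^ 4) (by fun_prop))
    have t2 := hb6.mul (hone (fun β : ℝ => -(ν + 1/2) * q2 + (4*ν ^ 2 - 1)/8 * q1 +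
      (4*ν ^ 2 - 1)/8 * q2 * (β/α) ^ 2) (by fun_prop))
    have t3 := t1.add t2
    simp only [mul_one] at t3
    refine t3.congr_left fun β => ?_
    ring
  have hAC := hA.mul (isBigO_refl C (nhds (0:ℝ)))
  -- second part
  have hRO : R =O[nhds (0:ℝ)] fun β : ℝ => |β/α| ^ 6 * C β := by
    have hD : 0 < (2/α) ^ k * (2/α) ^ m / (Real.sqrt π * Real.Gamma (ν + 1/2)) * W / α ^ 6 := by
      positivity
    set D := (2/α) ^ k * (2/α) ^ m / (Real.sqrt π * Real.Gamma (ν + 1/2)) * W / α ^ 6 with hDdef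
    refine IsBigO.of_bound (B / D) ?_
    filter_upwards [hev] with β hβ
    have hn : ‖|β/α| ^ 6 * C β‖ = D * |β| ^ (6 + m) := by
      have : |β/α| ^ 6 * C β = D * (|β| ^ 6 * β ^ m) := by
        simp only [hC, hDdef]
        rw [abs_div, abs_of_pos hα, div_pow, show 2 * β / α = (2 / α) * β by ring,
          mul_pow (2 / α) β]
        ring
      rw [this, norm_mul, norm_mul, norm_pow, norm_pow, Real.norm_of_nonneg hD.le, Real.norm_eq_abs |β|, abs_abs,
        Real.norm_eq_abs, pow_add]
    rw [hn, ← mul_assoc, div_mul_cancel₀ _ hD.ne']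
    exact hB β hβ
  have hprefO : pref =O[nhds (0:ℝ)] fun _ => (1:ℝ) := by
    have hc : ContinuousAt pref 0 := by
      refine ContinuousAt.div_const (ContinuousAt.rpow_const (by fun_prop) (Or.inl ?_)) _
      have : α ≠ 0 := hα.ne'
      simpa using this
    exact hc.tendsto.isBigO_one ℝ
  have h2 := hprefO.mul hRO
  simp only [one_mul] at h2
  refine (hAC.add h2).congr' ?_ (Filter.EventuallyEq.rfl)
  filter_upwards [hev] with β hβ
  have hp := hpref β hβ
  rw [hμ]
  simp only [hR]
  change pref β * (β ^ m * U) = C β * _ at hp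
  linear_combination (-(1 + q1 * (β/α) ^ 2 + q2 * (β/α) ^ 4)) * hp

lemma ceil_half (k : ℕ) : k + k % 2 = 2 * ⌈(k : ℝ)/2⌉₊ := by
  rcases Nat.even_or_odd' k with ⟨r, rfl | rfl⟩
  · have : ((2 * r : ℕ) : ℝ) / 2 = r := by push_cast; ring
    rw [this, Nat.ceil_natCast]; omega
  · have : ⌈((2 * r + 1 : ℕ) : ℝ) / 2⌉₊ = r + 1 := by
      rw [Nat.ceil_eq_iff (by omega)]
      push_cast
      constructor <;> norm_num <;> linarith
    rw [this]; omega

open Asymptotics in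
theorem vg_moment_expansion (ν α : ℝ) (hν : ν > -1/2) (hα : 0 < α) (k : ℕ) (hk : 0 < k) :
    (fun β : ℝ =>
        (∫ x : ℝ, x ^ k * vgDensity ν α β x) -
          ((2/α) ^ k * (2*β/α) ^ (k % 2) / (Real.sqrt π * Real.Gamma (ν + 1/2)) *
              (Real.Gamma (ν + ((⌈(k : ℝ)/2⌉₊ : ℝ) + 1/2)) *
                Real.Gamma ((⌈(k : ℝ)/2⌉₊ : ℝ) + 1/2))) *
            (1 +
              (2 * ((⌈(k : ℝ)/2⌉₊ : ℝ) + 1/2) * (((⌈(k : ℝ)/2⌉₊ : ℝ) + 1/2) + ν) /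
                  (2 * ((k % 2 : ℕ) : ℝ) + 1) - ν - 1/2) * (β/α) ^ 2 +
              (2 * ((⌈(k : ℝ)/2⌉₊ : ℝ) + 1/2) * (((⌈(k : ℝ)/2⌉₊ : ℝ) + 1/2) + 1) *
                  (((⌈(k : ℝ)/2⌉₊ : ℝ) + 1/2) + ν) * (((⌈(k : ℝ)/2⌉₊ : ℝ) + 1/2) + ν + 1) /
                  (4 * ((k % 2 : ℕ) : ℝ) ^ 2 + 8 * ((k % 2 : ℕ) : ℝ) + 3) -
                ((⌈(k : ℝ)/2⌉₊ : ℝ) + 1/2) * (2*ν + 1) * (((⌈(k : ℝ)/2⌉₊ : ℝ) + 1/2) + ν) /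
                  (2 * ((k % 2 : ℕ) : ℝ) + 1) +
                (4*ν ^ 2 - 1)/8) * (β/α) ^ 4))
      =O[nhds (0 : ℝ)]
        fun β : ℝ => |β/α| ^ 6 *
          ((2/α) ^ k * (2*β/α) ^ (k % 2) / (Real.sqrt π * Real.Gamma (ν + 1/2)) *
            (Real.Gamma (ν + ((⌈(k : ℝ)/2⌉₊ : ℝ) + 1/2)) *
              Real.Gamma ((⌈(k : ℝ)/2⌉₊ : ℝ) + 1/2))) :=
  vg_core ν α hν hα k _ _ (Nat.mod_two_eq_zero_or_one k) (ceil_half k)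
end
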